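/- Consider a Markov chain choice model without the 'no purchase' option, let r ∈ {2,…,n−1}, fix i ∈ N and S_∩ ⊆ N \ {i} with |S_∩| = r − 1, and let 𝒮 := { S_∩ ∪ {k} : k ∈ N \ (S_∩ ∪ {i}) } (a family of n − r assortments of size r, none containing i). Then dim(Span ⋃_{S∈𝒮} { h_{j,S} : j ∈ S }) ≥ n − 1. -/

import Mathlib

open Matrix Filter Finset

/-- The product-by-product submatrix `ρ̃` of the transition matrix
(rows/columns indexed by the products `1,…,n`, i.e. the nonzero states). -/
def subRho {n : ℕ} (rho : Matrix (Fin (n+1)) (Fin (n+1)) ℝ) : Matrix (Fin n) (Fin n) ℝ :=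
  Matrix.of fun i j => rho i.succ j.succ

/-- Markov chain choice model: `lam` is a probability vector on the states `{0,1,…,n}`,
`rho` is row-stochastic, state `0` (no purchase) is absorbing, there are no self-loops on
product states, and the product-by-product submatrix `ρ̃` is irreducible. -/
def IsMCCM {n : ℕ} (lam : Fin (n+1) → ℝ) (rho : Matrix (Fin (n+1)) (Fin (n+1)) ℝ) : Prop :=
  (∀ i, 0 ≤ lam i) ∧ (∑ i, lam i = 1) ∧
  (∀ i j, 0 ≤ rho i j) ∧ (∀ i, ∑ j, rho i j = 1) ∧
  rho 0 0 = 1 ∧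
  (∀ i : Fin (n+1), i ≠ 0 → rho i i = 0) ∧
  (∀ i j : Fin n, ∃ t : ℕ, 1 ≤ t ∧ 0 < (subRho rho ^ t) i j)

/-- `ρ^S`: the transition matrix with every row `i ∈ S` replaced by the `i`-th standard
basis vector, so that all states of `S ∪ {0}` are absorbing. -/
def absorb {n : ℕ} (rho : Matrix (Fin (n+1)) (Fin (n+1)) ℝ) (S : Finset (Fin (n+1))) :
    Matrix (Fin (n+1)) (Fin (n+1)) ℝ :=
  Matrix.of fun i j => if i ∈ S then (if j = i then (1 : ℝ) else 0) else rho i j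

/-- The conditional choice probability `π(j, S ∣ i) := lim_{t→∞} ((ρ^S)^t)_{i,j}`. -/
noncomputable def condProb {n : ℕ} (rho : Matrix (Fin (n+1)) (Fin (n+1)) ℝ)
    (S : Finset (Fin (n+1))) (i j : Fin (n+1)) : ℝ :=
  limUnder atTop fun t : ℕ => (absorb rho S ^ t) i j

/-- The choice probability `π(j, S) := ∑_{k ∈ N₊} λ_k · π(j, S ∣ k)`. -/
noncomputable def choiceProb {n : ℕ} (lam : Fin (n+1) → ℝ)
    (rho : Matrix (Fin (n+1)) (Fin (n+1)) ℝ) (S : Finset (Fin (n+1))) (j : Fin (n+1)) : ℝ :=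
  ∑ k, lam k * condProb rho S k j

/-- The vector `h_{j,S} = (π(j, S ∣ k))_{k ∈ N} ∈ ℝ^n` (no "no purchase" option). -/
noncomputable def hvecN {n : ℕ} (rho : Matrix (Fin (n+1)) (Fin (n+1)) ℝ)
    (S : Finset (Fin (n+1))) (j : Fin (n+1)) : Fin n → ℝ :=
  fun k => condProb rho S k.succ j

/-- A function that is harmonic off a nonempty set and nonpositive on it is nonpositive. -/
theorem nonpos_of_harmonic_off {ι : Type*} [Fintype ι] [DecidableEq ι] {Q : Matrix ι ι ℝ}
    (hQ0 : ∀ a b, 0 ≤ Q a b) (hQ1 : ∀ a, ∑ b, Q a b = 1)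
    (hQirr : ∀ a b, ∃ t : ℕ, 1 ≤ t ∧ 0 < (Q ^ t) a b)
    {T : Set ι} (hT : T.Nonempty) {f : ι → ℝ} (hfT : ∀ a ∈ T, f a ≤ 0)
    (hf : ∀ a ∉ T, f a = (Q *ᵥ f) a) (a : ι) : f a ≤ 0 := by
  obtain ⟨s, hs⟩ := hT
  obtain ⟨m, -, hm⟩ := Finset.exists_max_image Finset.univ f ⟨a, Finset.mem_univ a⟩
  by_contra! ha
  have hmpos : 0 < f m := ha.trans_le (hm a (Finset.mem_univ a))
  have hstep : ∀ b c, f b = f m → Q b c ≠ 0 → f c = f m := by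
    intro b c hb hbc
    have hbT : b ∉ T := fun hbT => by linarith [hfT b hbT]
    have hsum : ∑ d, Q b d * (f m - f d) = 0 := by
      have hharm : f b = ∑ d, Q b d * f d := hf b hbT
      simp only [mul_sub, Finset.sum_sub_distrib, ← Finset.sum_mul, hQ1 b]
      linarith
    have hzero := (Finset.sum_eq_zero_iff_of_nonneg (fun d _ =>
      mul_nonneg (hQ0 b d) (sub_nonneg.2 (hm d (Finset.mem_univ d))))).1 hsum c
        (Finset.mem_univ c)
    rcases mul_eq_zero.1 hzero with h | h
    · exact absurd h hbc
    · linarith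
  have hpow : ∀ (t : ℕ) (c : ι), (Q ^ t) m c ≠ 0 → f c = f m := by
    intro t
    induction t with
    | zero =>
      intro c hc
      by_cases hmc : m = c
      · rw [hmc]
      · simp [hmc] at hc
    | succ t ih =>
      intro c hc
      rw [pow_succ, Matrix.mul_apply] at hc
      obtain ⟨d, -, hd⟩ := Finset.exists_ne_zero_of_sum_ne_zero hc
      exact hstep d c (ih d (left_ne_zero_of_mul hd)) (right_ne_zero_of_mul hd)
  obtain ⟨t, -, ht⟩ := hQirr m s
  linarith [hpow t s ht.ne', hfT s hs]

/-- A function that is harmonic off a nonempty set and vanishes on it is zero. -/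
theorem eq_zero_of_harmonic_off {ι : Type*} [Fintype ι] [DecidableEq ι] {Q : Matrix ι ι ℝ}
    (hQ0 : ∀ a b, 0 ≤ Q a b) (hQ1 : ∀ a, ∑ b, Q a b = 1)
    (hQirr : ∀ a b, ∃ t : ℕ, 1 ≤ t ∧ 0 < (Q ^ t) a b)
    {T : Set ι} (hT : T.Nonempty) {f : ι → ℝ} (hfT : ∀ a ∈ T, f a = 0)
    (hf : ∀ a ∉ T, f a = (Q *ᵥ f) a) (a : ι) : f a = 0 := by
  refine le_antisymm
    (nonpos_of_harmonic_off hQ0 hQ1 hQirr hT (fun b hb => (hfT b hb).le) hf a) ?_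
  have := nonpos_of_harmonic_off (f := -f) hQ0 hQ1 hQirr hT
    (fun b hb => by simp [hfT b hb])
    (fun b hb => by rw [Matrix.mulVec_neg, Pi.neg_apply, Pi.neg_apply, ← hf b hb]) a
  simpa using this

section Absorb

variable {n : ℕ} {rho : Matrix (Fin (n + 1)) (Fin (n + 1)) ℝ} {S : Finset (Fin (n + 1))}

theorem absorb_nonneg (h0 : ∀ a b, 0 ≤ rho a b) (a b : Fin (n + 1)) :
    0 ≤ absorb rho S a b := by
  unfold absorb
  rw [Matrix.of_apply]
  split_ifs
  exacts [zero_le_one, le_rfl, h0 a b]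

theorem sum_absorb (h1 : ∀ a, ∑ b, rho a b = 1) (a : Fin (n + 1)) :
    ∑ b, absorb rho S a b = 1 := by
  by_cases ha : a ∈ S <;> simp [absorb, ha, h1]

theorem absorb_pow_nonneg (h0 : ∀ a b, 0 ≤ rho a b) (t : ℕ) (a b : Fin (n + 1)) :
    0 ≤ (absorb rho S ^ t) a b := by
  induction t generalizing b with
  | zero =>
    rw [pow_zero, Matrix.one_apply]
    split_ifs <;> norm_num
  | succ t ih =>
    rw [pow_succ, Matrix.mul_apply]
    exact Finset.sum_nonneg fun c _ => mul_nonneg (ih c) (absorb_nonneg h0 c b)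

theorem sum_absorb_pow (h1 : ∀ a, ∑ b, rho a b = 1) (t : ℕ) (a : Fin (n + 1)) :
    ∑ b, (absorb rho S ^ t) a b = 1 := by
  induction t with
  | zero => simp [Matrix.one_apply]
  | succ t ih =>
    simp only [pow_succ, Matrix.mul_apply]
    rw [Finset.sum_comm]
    simp only [← Finset.mul_sum, sum_absorb h1, mul_one, ih]

theorem tendsto_condProb (h0 : ∀ a b, 0 ≤ rho a b) (h1 : ∀ a, ∑ b, rho a b = 1)
    {j : Fin (n + 1)} (hj : j ∈ S) (a : Fin (n + 1)) :
    Tendsto (fun t : ℕ => (absorb rho S ^ t) a j) atTop (nhds (condProb rho S a j)) := by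
  have hmono : Monotone fun t : ℕ => (absorb rho S ^ t) a j := by
    refine monotone_nat_of_le_succ fun t => ?_
    rw [pow_succ, Matrix.mul_apply]
    have hjj : absorb rho S j j = 1 := by simp [absorb, hj]
    calc (absorb rho S ^ t) a j = (absorb rho S ^ t) a j * absorb rho S j j := by
          rw [hjj, mul_one]
      _ ≤ _ := Finset.single_le_sum
          (f := fun c => (absorb rho S ^ t) a c * absorb rho S c j)
          (fun c _ => mul_nonneg (absorb_pow_nonneg h0 t a c) (absorb_nonneg h0 c j))
          (Finset.mem_univ j)
  have hbdd : BddAbove (Set.range fun t : ℕ => (absorb rho S ^ t) a j) := by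
    refine ⟨1, ?_⟩
    rintro _ ⟨t, rfl⟩
    rw [← sum_absorb_pow (S := S) h1 t a]
    exact Finset.single_le_sum (f := fun c => (absorb rho S ^ t) a c)
      (fun c _ => absorb_pow_nonneg h0 t a c) (Finset.mem_univ j)
  exact tendsto_nhds_limUnder ⟨_, tendsto_atTop_ciSup hmono hbdd⟩

theorem condProb_eq_sum (h0 : ∀ a b, 0 ≤ rho a b) (h1 : ∀ a, ∑ b, rho a b = 1)
    {j : Fin (n + 1)} (hj : j ∈ S) (a : Fin (n + 1)) :
    condProb rho S a j = ∑ c, absorb rho S a c * condProb rho S c j := by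
  have hl := (tendsto_add_atTop_iff_nat 1).2 (tendsto_condProb h0 h1 hj a)
  have hr : Tendsto (fun t : ℕ => ∑ c, absorb rho S a c * (absorb rho S ^ t) c j) atTop
      (nhds (∑ c, absorb rho S a c * condProb rho S c j)) :=
    tendsto_finsetSum _ fun c _ => (tendsto_condProb h0 h1 hj c).const_mul _
  refine tendsto_nhds_unique hl (hr.congr fun t => ?_)
  rw [pow_succ', Matrix.mul_apply]

theorem condProb_of_mem {a : Fin (n + 1)} (ha : a ∈ S) (j : Fin (n + 1)) :
    condProb rho S a j = if a = j then 1 else 0 := by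
  have hconst : ∀ t : ℕ, (absorb rho S ^ t) a j = if a = j then 1 else 0 := by
    intro t
    induction t with
    | zero => simp [Matrix.one_apply]
    | succ t ih =>
      rw [pow_succ', Matrix.mul_apply, ← ih]
      simp [absorb, ha]
  unfold condProb
  simp only [hconst]
  exact tendsto_const_nhds.limUnder_eq

theorem hvecN_of_mem {k : Fin n} (hk : k.succ ∈ S) (j : Fin (n + 1)) :
    hvecN rho S j k = if k.succ = j then 1 else 0 :=
  condProb_of_mem hk j

theorem hvecN_harmonic (h0 : ∀ a b, 0 ≤ rho a b) (h1 : ∀ a, ∑ b, rho a b = 1)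
    (hrho0 : ∀ a : Fin (n + 1), a ≠ 0 → rho a 0 = 0)
    {j : Fin (n + 1)} (hj : j ∈ S) {k : Fin n} (hk : k.succ ∉ S) :
    hvecN rho S j k = (subRho rho *ᵥ hvecN rho S j) k := by
  unfold hvecN
  rw [condProb_eq_sum h0 h1 hj, Fin.sum_univ_succ]
  simp [absorb, hk, hrho0 _ (Fin.succ_ne_zero k), Matrix.mulVec, dotProduct, subRho]

/-- The vectors `h_{x, S_x}`, where `S_x` adds to the nonempty set `T` the state `x`, or the fixed
state `k₀` if `x ∈ T` already, are linearly independent. -/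
theorem linearIndependent_hvecN (h0 : ∀ a b, 0 ≤ rho a b) (h1 : ∀ a, ∑ b, rho a b = 1)
    (hrho0 : ∀ a : Fin (n + 1), a ≠ 0 → rho a 0 = 0)
    (hirr : ∀ a b : Fin n, ∃ t : ℕ, 1 ≤ t ∧ 0 < (subRho rho ^ t) a b)
    {T : Finset (Fin (n + 1))} {s : Fin n} (hs : s.succ ∈ T) (k₀ : Fin (n + 1)) :
    LinearIndependent ℝ fun x : Fin n =>
      hvecN rho (insert (if x.succ ∈ T then k₀ else x.succ) T) x.succ := by
  have hQ1 : ∀ a, ∑ b, subRho rho a b = 1 := fun a => by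
    simpa [Fin.sum_univ_succ, hrho0 _ (Fin.succ_ne_zero a), subRho] using h1 a.succ
  have hmem : ∀ x : Fin n, x.succ ∈ insert (if x.succ ∈ T then k₀ else x.succ) T := by
    intro x
    by_cases hx : x.succ ∈ T <;> simp [hx]
  rw [Fintype.linearIndependent_iff]
  intro g hg
  have hoff : ∀ y : Fin n, y.succ ∉ T → y.succ ≠ k₀ → g y = 0 := by
    intro y hyT hyk
    let L : (Fin n → ℝ) →ₗ[ℝ] Fin n → ℝ := LinearMap.id - (subRho rho).mulVecLin
    have hD : L _ y = L 0 y := congrFun (congrArg L hg) y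
    simp only [L, map_sum, map_smul, map_zero, Finset.sum_apply, Pi.smul_apply, smul_eq_mul,
      LinearMap.sub_apply, LinearMap.id_apply, Matrix.mulVecLin_apply, Pi.sub_apply,
      Pi.zero_apply] at hD
    rw [Finset.sum_eq_single y] at hD
    · refine (mul_eq_zero.1 hD).resolve_right fun hLy => ?_
      rw [if_neg hyT] at hLy
      have hyy : hvecN rho (insert y.succ T) y.succ y = 1 := by
        rw [hvecN_of_mem (Finset.mem_insert_self _ _), if_pos rfl]
      refine one_ne_zero (hyy.symm.trans (eq_zero_of_harmonic_off (Q := subRho rho)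
        (fun a b => h0 _ _) hQ1 hirr
        (T := {a : Fin n | a.succ ∈ T}) ⟨s, hs⟩ ?_ ?_ y))
      · intro a ha
        rw [hvecN_of_mem (Finset.mem_insert_of_mem ha), if_neg]
        exact fun hay => hyT (hay ▸ ha)
      · intro a ha
        by_cases hay : a = y
        · subst hay
          exact sub_eq_zero.1 hLy
        · refine hvecN_harmonic h0 h1 hrho0 (Finset.mem_insert_self _ _) ?_
          rw [Finset.mem_insert, not_or]
          exact ⟨fun h => hay (Fin.succ_injective _ h), ha⟩
    · intro x _ hxy
      rw [hvecN_harmonic h0 h1 hrho0 (hmem x) (k := y), sub_self, mul_zero]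
      rw [Finset.mem_insert, not_or]
      refine ⟨?_, hyT⟩
      split_ifs
      · exact hyk
      · exact fun h => hxy (Fin.succ_injective _ h).symm
    · simp
  intro y
  by_cases hy : y.succ ∉ T ∧ y.succ ≠ k₀
  · exact hoff y hy.1 hy.2
  have hev := congrFun hg y
  simp only [Finset.sum_apply, Pi.smul_apply, smul_eq_mul, Pi.zero_apply] at hev
  rw [Finset.sum_eq_single y] at hev
  · rwa [hvecN_of_mem (hmem y), if_pos rfl, mul_one] at hev
  · intro x _ hxy
    by_cases hx : x.succ ∉ T ∧ x.succ ≠ k₀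
    · rw [hoff x hx.1 hx.2, zero_mul]
    · have hK : (if x.succ ∈ T then k₀ else x.succ) = k₀ := by
        split_ifs with h
        · rfl
        · by_contra hne
          exact hx ⟨h, hne⟩
      rw [hK, hvecN_of_mem, if_neg fun h => hxy (Fin.succ_injective _ h).symm, mul_zero]
      rw [Finset.mem_insert]
      tauto
  · simp

end Absorb

/-- (No "no purchase" option.)  Let `r ∈ {2,…,n−1}`, fix a product `i`
and `S_∩ ⊆ N \ {i}` with `|S_∩| = r − 1`, and let
`𝒮 = {S_∩ ∪ {k} : k ∈ N \ (S_∩ ∪ {i})}`.  Then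
`dim Span(⋃_{S ∈ 𝒮} {h_{j,S} : j ∈ S}) ≥ n − 1`. -/
theorem mccm_dim_assortment_choice {n : ℕ} (hn : 2 ≤ n)
    (lam : Fin (n+1) → ℝ) (rho : Matrix (Fin (n+1)) (Fin (n+1)) ℝ)
    (h : IsMCCM lam rho)
    (hlam0 : lam 0 = 0) (hrho0 : ∀ i : Fin (n+1), i ≠ 0 → rho i 0 = 0)
    (r : ℕ) (hr : 2 ≤ r) (hrn : r ≤ n - 1)
    (i : Fin (n+1)) (hi : i ≠ 0)
    (Scap : Finset (Fin (n+1))) (hScap0 : (0 : Fin (n+1)) ∉ Scap)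
    (hScapi : i ∉ Scap) (hScapcard : Scap.card = r - 1) :
    Module.finrank ℝ
      ↥(Submodule.span ℝ
        {x : Fin n → ℝ | ∃ k : Fin (n+1), k ≠ 0 ∧ k ∉ Scap ∧ k ≠ i ∧
          ∃ j ∈ insert k Scap, x = hvecN rho (insert k Scap) j}) ≥ n - 1 := by
  obtain ⟨-, -, h0, h1, -, -, hirr⟩ := h
  obtain ⟨i', rfl⟩ := Fin.exists_succ_eq.2 hi
  obtain ⟨s, hsT⟩ : Scap.Nonempty := Finset.card_pos.1 (by omega)
  obtain ⟨s', rfl⟩ := Fin.exists_succ_eq.2 (ne_of_mem_of_not_mem hsT hScap0)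
  obtain ⟨k₀, hk₀⟩ : ∃ k₀, k₀ ∉ insert 0 (insert i'.succ Scap) := by
    by_contra! hall
    have huniv := Finset.eq_univ_of_forall hall
    have hcard := congrArg Finset.card huniv
    rw [Finset.card_univ, Fintype.card_fin] at hcard
    have := Finset.card_insert_le 0 (insert i'.succ Scap)
    have := Finset.card_insert_le i'.succ Scap
    omega
  simp only [Finset.mem_insert, not_or] at hk₀
  have hli := (linearIndependent_hvecN h0 h1 hrho0 hirr hsT k₀).comp
    (Subtype.val : {x : Fin n // x ≠ i'} → Fin n) Subtype.val_injective
  have hrank := finrank_span_eq_card hli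
  rw [Fintype.card_subtype_compl, Fintype.card_fin, Fintype.card_subtype_eq] at hrank
  rw [ge_iff_le, ← hrank]
  refine Submodule.finrank_mono (Submodule.span_mono ?_)
  rintro _ ⟨⟨x, hx⟩, rfl⟩
  by_cases hxT : x.succ ∈ Scap
  · exact ⟨k₀, hk₀.1, hk₀.2.2, hk₀.2.1, x.succ, Finset.mem_insert_of_mem hxT, by simp [hxT]⟩
  · exact ⟨x.succ, Fin.succ_ne_zero x, hxT, fun h => hx (Fin.succ_injective _ h), x.succ,
      Finset.mem_insert_self _ _, by simp [hxT]⟩
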